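/- Let z ∈ ℂ \ [0,∞). Then there exists a solution θ(·,z) of the Schrödinger equation with spectral parameter z on [0,∞) and a constant C such that, for all x ≥ x₁(z), |θ(x,z) − a(x,z)| ≤ C ε(x)|a(x,z)| and |θ'(x,z) + √(−z/p₀)·a(x,z)| ≤ C ε(x)|a(x,z)|. Moreover, if Im z ≠ 0 then θ(·,z) is square integrable on (0,∞). -/

import Mathlib

open MeasureTheory Filter Set Complex

noncomputable section

/-- The principal-branch square root `ω(x,z) = ((q x − z)/p x)^{1/2}`. -/
def omg (p q : ℝ → ℝ) (z : ℂ) (x : ℝ) : ℂ :=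
  (((q x : ℂ) - z) / (p x : ℂ)) ^ (1 / 2 : ℂ)

/-- `Ω(x,z) = ∫₀ˣ ω(y,z) dy`. -/
def Omg (p q : ℝ → ℝ) (z : ℂ) (x : ℝ) : ℂ :=
  ∫ y in (0:ℝ)..x, omg p q z y

/-- `a(x,z) = exp(−Ω(x,z))`. -/
def aa (p q : ℝ → ℝ) (z : ℂ) (x : ℝ) : ℂ :=
  Complex.exp (-(Omg p q z x))

/-- Assumption (PQ): `p > 0` on `[0,∞)`, locally absolutely continuous with integrable
derivative `p'` and limit `p₀ > 0` at `+∞`; `q` integrable on `(0,x₀)`, locally absolutely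
continuous on `[x₀,∞)` with integrable derivative `q'` there, and `q → 0` at `+∞`.
Absolute continuity is encoded by the fundamental theorem of calculus representation. -/
structure PQData (p p' q q' : ℝ → ℝ) (p₀ x₀ : ℝ) : Prop where
  p_pos : ∀ x : ℝ, 0 ≤ x → 0 < p x
  hp₀ : 0 < p₀
  hx₀ : 0 ≤ x₀
  p_ac : ∀ x : ℝ, 0 ≤ x → p x = p 0 + ∫ t in (0:ℝ)..x, p' t
  p'_int : IntegrableOn p' (Ioi (0:ℝ))
  p_lim : Tendsto p atTop (nhds p₀)
  q_int : IntegrableOn q (Ioo (0:ℝ) x₀)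
  q_ac : ∀ x : ℝ, x₀ ≤ x → q x = q x₀ + ∫ t in x₀..x, q' t
  q'_int : IntegrableOn q' (Ioi x₀)
  q_lim : Tendsto q atTop (nhds (0:ℝ))

/-- `f` (with derivative `f'`) solves `−(p f')' + q f = z f` on `I`:
`f` is differentiable on `I` with derivative `f'`, and `p·f'` is locally absolutely
continuous on `I` with a.e. derivative `(q − z)·f` (encoded via the FTC representation). -/
def IsSol (p q : ℝ → ℝ) (z : ℂ) (I : Set ℝ) (f f' : ℝ → ℂ) : Prop :=
  (∀ x ∈ I, HasDerivWithinAt f (f' x) I x) ∧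
    ∀ x ∈ I, ∀ y ∈ I,
      (p y : ℂ) * f' y - (p x : ℂ) * f' x = ∫ t in x..y, ((q t : ℂ) - z) * f t

/-- `ε(x) = ∫ₓ^∞ (|p'| + |q'|)`. -/
def eps (p' q' : ℝ → ℝ) (x : ℝ) : ℝ :=
  ∫ y in Ioi x, (|p' y| + |q' y|)

/-- The Volterra kernel `G(x,y,z) = a(y,z)² ∫ₓ^y p(s)⁻¹ a(s,z)⁻² ds`. -/
def Gker (p q : ℝ → ℝ) (z : ℂ) (x y : ℝ) : ℂ :=
  aa p q z y ^ 2 * ∫ s in x..y, ((p s : ℂ))⁻¹ * (aa p q z s ^ 2)⁻¹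

/-- `Φ(x,λ) = ∫₀ˣ √(max((λ − q)/p, 0))`. -/
def Phi (p q : ℝ → ℝ) (lam x : ℝ) : ℝ :=
  ∫ y in (0:ℝ)..x, Real.sqrt (max ((lam - q y) / p y) 0)

/-- `K(λ) = exp(−∫₀^∞ √(max((q − λ)/p, 0)))`. -/
def Kc (p q : ℝ → ℝ) (lam : ℝ) : ℝ :=
  Real.exp (-∫ y in Ioi (0:ℝ), Real.sqrt (max ((q y - lam) / p y) 0))

/-- `ξ(x) = θ(x)·∫_ϱ^x θ(y)⁻² p(y)⁻¹ dy`. -/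
def xiFun (p : ℝ → ℝ) (θ : ℝ → ℂ) (ϱ x : ℝ) : ℂ :=
  θ x * ∫ y in ϱ..x, (θ y ^ 2)⁻¹ * ((p y : ℂ))⁻¹

/-- The derivative of `ξ`: `ξ'(x) = θ'(x)·∫_ϱ^x θ⁻² p⁻¹ + θ(x)⁻¹ p(x)⁻¹`. -/
def xiFun' (p : ℝ → ℝ) (θ θ' : ℝ → ℂ) (ϱ x : ℝ) : ℂ :=
  θ' x * (∫ y in ϱ..x, (θ y ^ 2)⁻¹ * ((p y : ℂ))⁻¹) + (θ x)⁻¹ * ((p x : ℂ))⁻¹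


/-- Fundamental theorem of calculus from a local estimate. -/
lemma ac_ftc {E : Type*} [NormedAddCommGroup E] [NormedSpace ℝ E]
    {F g : ℝ → E} {m : ℝ → ℝ} {a b : ℝ} (hab : a ≤ b)
    (hF : ContinuousOn F (Icc a b)) (hg : IntervalIntegrable g volume a b)
    (hm : IntervalIntegrable m volume a b)
    (h : ∀ x ∈ Ico a b, ∀ δ > 0, ∀ᶠ y in nhdsWithin x (Ioi x), y ≤ b →
      ‖F y - F x - ∫ t in x..y, g t‖ ≤ δ * ∫ t in x..y, m t) :
    F b - F a = ∫ t in a..b, g t := by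
  have hui : uIcc a b = Icc a b := uIcc_of_le hab
  have hgc : ContinuousOn (fun x => ∫ t in a..x, g t) (Icc a b) := by
    rw [← hui]
    apply intervalIntegral.continuousOn_primitive_interval
    rw [hui, integrableOn_Icc_iff_integrableOn_Ioc]
    exact (intervalIntegrable_iff_integrableOn_Ioc_of_le hab).1 hg
  have hmc : ContinuousOn (fun x => ∫ t in a..x, m t) (Icc a b) := by
    rw [← hui]
    apply intervalIntegral.continuousOn_primitive_interval
    rw [hui, integrableOn_Icc_iff_integrableOn_Ioc]
    exact (intervalIntegrable_iff_integrableOn_Ioc_of_le hab).1 hm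
  have key : ∀ δ > 0, ‖F b - F a - ∫ t in a..b, g t‖ ≤ δ * ∫ t in a..b, m t := by
    intro δ hδ
    let s : Set ℝ := {x | ‖F x - F a - ∫ t in a..x, g t‖ ≤ δ * ∫ t in a..x, m t}
    have hcl : IsClosed (s ∩ Icc a b) := by
      have h1 : ContinuousOn (fun x => δ * (∫ t in a..x, m t) - ‖F x - F a - ∫ t in a..x, g t‖)
          (Icc a b) :=
        (continuousOn_const.mul hmc).sub ((hF.sub continuousOn_const).sub hgc).norm
      have h2 := h1.preimage_isClosed_of_isClosed isClosed_Icc (isClosed_Ici (a := (0:ℝ)))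
      convert h2 using 1
      ext x
      simp [s, and_comm]
    have hsub : Icc a b ⊆ s := by
      apply hcl.Icc_subset_of_forall_exists_gt
      · simp [s]
      · rintro x ⟨hxs, hx⟩ y hy
        have hx' : x < min y b := lt_min hy hx.2
        have h3 : ∀ᶠ w in nhdsWithin x (Ioi x), w ∈ Ioc x (min y b) := Ioc_mem_nhdsGT hx'
        obtain ⟨w, hw1, hw2⟩ := ((h x hx δ hδ).and h3).exists
        have hwb : w ≤ b := hw2.2.trans (min_le_right _ _)
        refine ⟨w, ?_, hw2.1, hw2.2.trans (min_le_left _ _)⟩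
        have hw1 := hw1 hwb
        have e1 : (∫ t in a..x, g t) + ∫ t in x..w, g t = ∫ t in a..w, g t := by
          apply intervalIntegral.integral_add_adjacent_intervals
          · exact hg.mono_set (by rw [hui, uIcc_of_le hx.1]; exact Icc_subset_Icc_right hx.2.le)
          · exact hg.mono_set (by rw [hui, uIcc_of_le hw2.1.le]; exact Icc_subset_Icc hx.1 hwb)
        have e2 : (∫ t in a..x, m t) + ∫ t in x..w, m t = ∫ t in a..w, m t := by
          apply intervalIntegral.integral_add_adjacent_intervals
          · exact hm.mono_set (by rw [hui, uIcc_of_le hx.1]; exact Icc_subset_Icc_right hx.2.le)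
          · exact hm.mono_set (by rw [hui, uIcc_of_le hw2.1.le]; exact Icc_subset_Icc hx.1 hwb)
        change ‖F w - F a - ∫ t in a..w, g t‖ ≤ δ * ∫ t in a..w, m t
        have hxs' : ‖F x - F a - ∫ t in a..x, g t‖ ≤ δ * ∫ t in a..x, m t := hxs
        rw [← e1, ← e2]
        calc ‖F w - F a - ((∫ t in a..x, g t) + ∫ t in x..w, g t)‖
            = ‖(F x - F a - ∫ t in a..x, g t) + (F w - F x - ∫ t in x..w, g t)‖ := by
              congr 1; abel
          _ ≤ _ := norm_add_le _ _
          _ ≤ _ := by rw [mul_add]; exact add_le_add hxs' hw1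
    exact hsub ⟨hab, le_rfl⟩
  have : ‖F b - F a - ∫ t in a..b, g t‖ ≤ 0 := by
    have ht : Tendsto (fun δ : ℝ => δ * ∫ t in a..b, m t) (nhdsWithin 0 (Ioi 0)) (nhds 0) := by
      have : Tendsto (fun δ : ℝ => δ * ∫ t in a..b, m t) (nhds 0) (nhds (0 * ∫ t in a..b, m t)) :=
        (continuous_id.mul continuous_const).tendsto 0
      rw [zero_mul] at this
      exact this.mono_left nhdsWithin_le_nhds
    apply ge_of_tendsto ht
    filter_upwards [self_mem_nhdsWithin] with δ hδ using key δ hδ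
  exact sub_eq_zero.1 (norm_le_zero_iff.1 this)

/-- `u` is absolutely continuous on `[a,b]` with derivative `u'`. -/
structure ACI {𝕜 : Type*} [RCLike 𝕜] (u u' : ℝ → 𝕜) (a b : ℝ) : Prop where
  int : IntervalIntegrable u' volume a b
  eq : ∀ x ∈ Icc a b, u x - u a = ∫ t in a..x, u' t

namespace ACI
variable {𝕜 : Type*} [RCLike 𝕜] {u u' v v' : ℝ → 𝕜} {a b : ℝ}

lemma mono_right (h : ACI u u' a b) {c : ℝ} (hac : a ≤ c) (hcb : c ≤ b) : ACI u u' a c :=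
  ⟨h.int.mono_set (by rw [uIcc_of_le hac, uIcc_of_le (hac.trans hcb)]; exact Icc_subset_Icc_right hcb),
    fun x hx => h.eq x ⟨hx.1, hx.2.trans hcb⟩⟩

lemma int' (h : ACI u u' a b) {x y : ℝ} (hax : a ≤ x) (hxy : x ≤ y) (hyb : y ≤ b) :
    IntervalIntegrable u' volume x y :=
  h.int.mono_set (by
    rw [uIcc_of_le hxy, uIcc_of_le (hax.trans (hxy.trans hyb))]; exact Icc_subset_Icc hax hyb)

lemma eq' (h : ACI u u' a b) {x y : ℝ} (hax : a ≤ x) (hxy : x ≤ y) (hyb : y ≤ b) :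
    u y - u x = ∫ t in x..y, u' t := by
  have e := intervalIntegral.integral_add_adjacent_intervals
    (h.int' le_rfl hax (hxy.trans hyb)) (h.int' hax hxy hyb)
  rw [← h.eq x ⟨hax, hxy.trans hyb⟩, ← h.eq y ⟨hax.trans hxy, hyb⟩] at e
  linear_combination -e

lemma cont (h : ACI u u' a b) (hab : a ≤ b) : ContinuousOn u (Icc a b) := by
  have hui : uIcc a b = Icc a b := uIcc_of_le hab
  have hgc : ContinuousOn (fun x => u a + ∫ t in a..x, u' t) (Icc a b) := by
    rw [← hui]
    apply continuousOn_const.add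
    apply intervalIntegral.continuousOn_primitive_interval
    rw [hui, integrableOn_Icc_iff_integrableOn_Ioc]
    exact (intervalIntegrable_iff_integrableOn_Ioc_of_le hab).1 h.int
  apply hgc.congr
  intro x hx
  change u x = u a + ∫ t in a..x, u' t
  rw [← h.eq x hx]; ring

lemma near {f : ℝ → 𝕜} (hf : ContinuousOn f (Icc a b)) {x : ℝ} (hx : x ∈ Ico a b) {δ : ℝ}
    (hδ : 0 < δ) : ∀ᶠ y in nhdsWithin x (Ioi x), y ≤ b → ∀ t ∈ Icc x y, ‖f t - f x‖ ≤ δ := by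
  have h1 : ContinuousWithinAt f (Icc x b) x :=
    (hf x ⟨hx.1, hx.2.le⟩).mono (Icc_subset_Icc_left hx.1)
  rw [Metric.continuousWithinAt_iff] at h1
  obtain ⟨ε, hε, h⟩ := h1 δ hδ
  have : ∀ᶠ y in nhdsWithin x (Ioi x), y ∈ Ioc x (x + ε / 2) := Ioc_mem_nhdsGT (by linarith)
  filter_upwards [this] with y hy hyb t ht
  have := h (x := t) ⟨ht.1, ht.2.trans hyb⟩ (by
    rw [Real.dist_eq, abs_of_nonneg (by linarith [ht.1])]; linarith [ht.2, hy.2])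
  rw [dist_eq_norm] at this
  exact this.le

lemma mul_aux (hu : ACI u u' a b) (hv : ACI v v' a b) (hab : a ≤ b) :
    IntervalIntegrable (fun t => u' t * v t + u t * v' t) volume a b ∧
    u b * v b - u a * v a = ∫ t in a..b, (u' t * v t + u t * v' t) := by
  have hui : uIcc a b = Icc a b := uIcc_of_le hab
  have hcu := hu.cont hab
  have hcv := hv.cont hab
  have hint : IntervalIntegrable (fun t => u' t * v t + u t * v' t) volume a b :=
    (hu.int.mul_continuousOn (by rwa [hui])).add (hv.int.continuousOn_mul (by rwa [hui]))
  refine ⟨hint, ?_⟩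
  apply ac_ftc (F := fun x => u x * v x) (m := fun t => ‖u' t‖ + ‖v' t‖) hab (hcu.mul hcv) hint
    (hu.int.norm.add hv.int.norm)
  intro x hx δ hδ
  have hlt : ∀ᶠ y in nhdsWithin x (Ioi x), x < y := self_mem_nhdsWithin
  filter_upwards [near hcu hx (half_pos hδ), near hcv hx (half_pos hδ), hlt] with y h1 h2 hxy hyb
  have h1 := h1 hyb
  have h2 := h2 hyb
  have sub : ∀ {f : ℝ → 𝕜}, IntervalIntegrable f volume a b → IntervalIntegrable f volume x y :=
    fun hf => hf.mono_set (by rw [hui, uIcc_of_le hxy.le]; exact Icc_subset_Icc hx.1 hyb)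
  have e : u y * v y - u x * v x = ∫ t in x..y, (u' t * v x + u y * v' t) := by
    rw [intervalIntegral.integral_add ((sub hu.int).mul_const _) ((sub hv.int).const_mul _),
      intervalIntegral.integral_mul_const, intervalIntegral.integral_const_mul,
      ← hu.eq' hx.1 hxy.le hyb, ← hv.eq' hx.1 hxy.le hyb]
    ring
  rw [e, ← intervalIntegral.integral_sub
    (((sub hu.int).mul_const _).add ((sub hv.int).const_mul _)) (sub hint),
    ← intervalIntegral.integral_const_mul]
  apply intervalIntegral.norm_integral_le_of_norm_le hxy.le
  · refine Eventually.of_forall fun t ht => ?_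
    have ht' : t ∈ Icc x y := Ioc_subset_Icc_self ht
    have a1 := h2 t ht'
    have a2 : ‖u y - u t‖ ≤ δ := by
      calc ‖u y - u t‖ = ‖(u y - u x) - (u t - u x)‖ := by congr 1; ring
        _ ≤ _ := norm_sub_le _ _
        _ ≤ δ := by linarith [h1 y ⟨hxy.le, le_rfl⟩, h1 t ht']
    calc ‖u' t * v x + u y * v' t - (u' t * v t + u t * v' t)‖
        = ‖-(u' t * (v t - v x)) + (u y - u t) * v' t‖ := by congr 1; ring
      _ ≤ ‖u' t‖ * ‖v t - v x‖ + ‖u y - u t‖ * ‖v' t‖ := by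
          refine (norm_add_le _ _).trans ?_
          rw [norm_neg, norm_mul, norm_mul]
      _ ≤ ‖u' t‖ * δ + δ * ‖v' t‖ := by gcongr; linarith
      _ = _ := by ring
  · refine IntervalIntegrable.const_mul ?_ δ
    exact ((sub hu.int).norm).add (sub hv.int).norm

lemma mul (hu : ACI u u' a b) (hv : ACI v v' a b) (hab : a ≤ b) :
    ACI (fun t => u t * v t) (fun t => u' t * v t + u t * v' t) a b :=
  ⟨(mul_aux hu hv hab).1, fun x hx =>
    (mul_aux (hu.mono_right hx.1 hx.2) (hv.mono_right hx.1 hx.2) hx.1).2⟩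

lemma comp_aux (hu : ACI u u' a b) (hab : a ≤ b) {φ φ' : 𝕜 → 𝕜}
    (hφ : ∀ x ∈ Icc a b, HasDerivAt φ (φ' (u x)) (u x))
    (hφ' : ContinuousOn (fun x => φ' (u x)) (Icc a b)) :
    IntervalIntegrable (fun t => φ' (u t) * u' t) volume a b ∧
    φ (u b) - φ (u a) = ∫ t in a..b, φ' (u t) * u' t := by
  have hui : uIcc a b = Icc a b := uIcc_of_le hab
  have hcu := hu.cont hab
  have hint : IntervalIntegrable (fun t => φ' (u t) * u' t) volume a b :=
    hu.int.continuousOn_mul (by rwa [hui])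
  refine ⟨hint, ?_⟩
  have hFc : ContinuousOn (fun x => φ (u x)) (Icc a b) := fun x hx =>
    (hφ x hx).continuousAt.comp_continuousWithinAt (hcu x hx)
  apply ac_ftc (F := fun x => φ (u x)) (m := fun t => ‖u' t‖) hab hFc hint hu.int.norm
  intro x hx δ hδ
  have hlt : ∀ᶠ y in nhdsWithin x (Ioi x), x < y := self_mem_nhdsWithin
  have hxI : x ∈ Icc a b := ⟨hx.1, hx.2.le⟩
  have hd := (hφ x hxI).isLittleO.def (half_pos hδ)
  have hd2 : ∀ᶠ y in nhdsWithin x (Ioi x), y ≤ b →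
      ‖φ (u y) - φ (u x) - (u y - u x) • φ' (u x)‖ ≤ δ / 2 * ‖u y - u x‖ := by
    obtain ⟨ε, hε, hball⟩ := Metric.eventually_nhds_iff.1 hd
    filter_upwards [near hcu hx (half_pos hε), hlt] with y hy hxy hyb
    apply hball
    rw [dist_eq_norm]
    linarith [hy hyb y ⟨hxy.le, le_rfl⟩]
  filter_upwards [near hφ' hx (half_pos hδ), hd2, hlt] with y h1 h2 hxy hyb
  have h1 := h1 hyb
  have h2 := h2 hyb
  have sub : ∀ {f : ℝ → 𝕜}, IntervalIntegrable f volume a b → IntervalIntegrable f volume x y :=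
    fun hf => hf.mono_set (by rw [hui, uIcc_of_le hxy.le]; exact Icc_subset_Icc hx.1 hyb)
  have e := hu.eq' hx.1 hxy.le hyb
  have n1 : ‖u y - u x‖ ≤ ∫ t in x..y, ‖u' t‖ := by
    rw [e]; exact intervalIntegral.norm_integral_le_integral_norm hxy.le
  have n2 : ‖φ' (u x) * (u y - u x) - ∫ t in x..y, φ' (u t) * u' t‖
      ≤ δ / 2 * ∫ t in x..y, ‖u' t‖ := by
    rw [e, ← intervalIntegral.integral_const_mul, ← intervalIntegral.integral_sub
      ((sub hu.int).const_mul _) (sub hint), ← intervalIntegral.integral_const_mul]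
    apply intervalIntegral.norm_integral_le_of_norm_le hxy.le
    · refine Eventually.of_forall fun t ht => ?_
      rw [← sub_mul, norm_mul, norm_sub_rev]
      gcongr
      exact h1 t (Ioc_subset_Icc_self ht)
    · exact ((sub hu.int).norm).const_mul _
  calc ‖φ (u y) - φ (u x) - ∫ t in x..y, φ' (u t) * u' t‖
      = ‖(φ (u y) - φ (u x) - (u y - u x) • φ' (u x)) +
          (φ' (u x) * (u y - u x) - ∫ t in x..y, φ' (u t) * u' t)‖ := by
        congr 1; rw [smul_eq_mul]; ring
    _ ≤ _ := norm_add_le _ _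
    _ ≤ δ / 2 * (∫ t in x..y, ‖u' t‖) + δ / 2 * ∫ t in x..y, ‖u' t‖ := by
        gcongr
        exact h2.trans (by gcongr)
    _ = _ := by ring

lemma comp (hu : ACI u u' a b) (hab : a ≤ b) {φ φ' : 𝕜 → 𝕜}
    (hφ : ∀ x ∈ Icc a b, HasDerivAt φ (φ' (u x)) (u x))
    (hφ' : ContinuousOn (fun x => φ' (u x)) (Icc a b)) :
    ACI (fun t => φ (u t)) (fun t => φ' (u t) * u' t) a b :=
  ⟨(comp_aux hu hab hφ hφ').1, fun x hx =>
    (comp_aux (hu.mono_right hx.1 hx.2) hx.1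
      (fun y hy => hφ y ⟨hy.1, hy.2.trans hx.2⟩)
      (hφ'.mono (Icc_subset_Icc_right hx.2))).2⟩

lemma of_deriv {u u' : ℝ → 𝕜} (hu : ∀ x, HasDerivAt u (u' x) x) (hc : Continuous u') (a b : ℝ) :
    ACI u u' a b :=
  ⟨hc.intervalIntegrable _ _, fun x _ =>
    (intervalIntegral.integral_eq_sub_of_hasDerivAt (fun y _ => hu y)
      (hc.intervalIntegrable _ _)).symm⟩

lemma of_tail {g : ℝ → 𝕜} (hg : ∀ x, IntegrableOn g (Ioi x)) (hab : a ≤ b) :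
    ACI (fun x => ∫ y in Ioi x, g y) (fun x => -g x) a b := by
  have h1 : ∀ x, a ≤ x → IntervalIntegrable g volume a x := fun x hx =>
    (intervalIntegrable_iff_integrableOn_Ioc_of_le hx).2
      ((hg a).mono_set Ioc_subset_Ioi_self)
  refine ⟨(h1 b hab).neg, fun x hx => ?_⟩
  rw [intervalIntegral.integral_neg, ← intervalIntegral.integral_Ioi_sub_Ioi (hg a) hx.1]
  ring

lemma continuous_of (h : ∀ a b, a ≤ b → ACI u u' a b) : Continuous u := by
  rw [continuous_iff_continuousAt]
  intro x
  exact ((h (x - 1) (x + 1) (by linarith)).cont (by linarith)).continuousAt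
    (Icc_mem_nhds (by linarith) (by linarith))

end ACI

lemma weight_bound {R : ℝ → ℂ} (hR : Integrable R) {M : ℝ} (hM : 0 < M) :
    Continuous (fun x => Real.exp (M * ∫ y in Ioi x, ‖R y‖)) ∧
    ∀ x, IntegrableOn (fun t => ‖R t‖ * Real.exp (M * ∫ y in Ioi t, ‖R y‖)) (Ioi x) ∧
      ∫ t in Ioi x, ‖R t‖ * Real.exp (M * ∫ y in Ioi t, ‖R y‖)
        ≤ Real.exp (M * ∫ y in Ioi x, ‖R y‖) / M := by
  set ε : ℝ → ℝ := fun x => ∫ y in Ioi x, ‖R y‖ with hε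
  have hr : ∀ x, IntegrableOn (fun y => ‖R y‖) (Ioi x) := fun x => hR.norm.integrableOn
  have hac : ∀ a b, a ≤ b → ACI ε (fun x => -‖R x‖) a b := fun a b hab => ACI.of_tail hr hab
  have hεc : Continuous ε := ACI.continuous_of hac
  have hwc : Continuous (fun x => Real.exp (M * ε x)) := by fun_prop
  refine ⟨hwc, fun x => ?_⟩
  have hle : ∀ t, ε t ≤ ∫ y, ‖R y‖ := fun t =>
    setIntegral_le_integral hR.norm (Eventually.of_forall fun _ => norm_nonneg _)
  have hint : IntegrableOn (fun t => ‖R t‖ * Real.exp (M * ε t)) (Ioi x) := by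
    refine Integrable.mul_bdd (c := Real.exp (M * ∫ y, ‖R y‖)) (hr x) hwc.aestronglyMeasurable ?_
    refine Eventually.of_forall fun t => ?_
    rw [Real.norm_of_nonneg (Real.exp_pos _).le]
    gcongr
    exact hle t
  refine ⟨hint, ?_⟩
  have ht := intervalIntegral_tendsto_integral_Ioi x hint tendsto_id
  apply le_of_tendsto ht
  filter_upwards [eventually_ge_atTop x] with b hb
  have h1 := ((hac x b hb).comp hb (φ := fun s => Real.exp (M * s))
    (φ' := fun s => Real.exp (M * s) * M)
    (fun t _ => by
      have := ((hasDerivAt_id (ε t)).const_mul M).exp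
      simpa using this)
    (by fun_prop)).eq b ⟨hb, le_rfl⟩
  have h2 : ∫ t in x..b, Real.exp (M * ε t) * M * -‖R t‖
      = -M * ∫ t in x..b, ‖R t‖ * Real.exp (M * ε t) := by
    rw [← intervalIntegral.integral_const_mul]
    congr 1; ext t; ring
  rw [h2] at h1
  rw [le_div_iff₀ hM]
  have := Real.exp_pos (M * ε b)
  simp only [id]
  linarith

lemma tail_integrable {R E f : ℝ → ℂ} (hR : Integrable R) (hE : Continuous E)
    (hEb : ∀ x, ∃ b, ∀ y, x ≤ y → ‖E y‖ ≤ b) (hf : Continuous f) {D : ℝ} (hD : ∀ x, ‖f x‖ ≤ D)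
    (x : ℝ) : IntegrableOn (fun y => E y * R y * f y) (Ioi x) := by
  obtain ⟨b, hb⟩ := hEb x
  refine Integrable.mul_bdd (c := D) ?_ hf.aestronglyMeasurable (Eventually.of_forall hD)
  refine Integrable.bdd_mul (c := b) hR.integrableOn hE.aestronglyMeasurable ?_
  exact (ae_restrict_iff' measurableSet_Ioi).2 (Eventually.of_forall fun y hy => hb y (le_of_lt hy))

section volt
variable {R E J : ℝ → ℂ} {κ : ℝ}

lemma EJ_bdd (hEb : ∀ x, ∃ b, ∀ y, x ≤ y → ‖E y‖ ≤ b)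
    (hK : ∀ x y, x ≤ y → ‖E y * (J y - J x)‖ ≤ κ) (x : ℝ) :
    ∃ b, ∀ y, x ≤ y → ‖E y * J y‖ ≤ b := by
  obtain ⟨b, hb⟩ := hEb x
  refine ⟨κ + b * ‖J x‖, fun y hy => ?_⟩
  calc ‖E y * J y‖ = ‖E y * (J y - J x) + E y * J x‖ := by congr 1; ring
    _ ≤ _ := norm_add_le _ _
    _ ≤ _ := by
      rw [norm_mul (E y) (J x)]
      gcongr
      · exact hK x y hy
      · exact hb y hy

lemma volt_split (hR : Integrable R) (hE : Continuous E) (hJ : Continuous J)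
    (hEb : ∀ x, ∃ b, ∀ y, x ≤ y → ‖E y‖ ≤ b)
    (hK : ∀ x y, x ≤ y → ‖E y * (J y - J x)‖ ≤ κ) {f : ℝ → ℂ}
    (hf : Continuous f) {D : ℝ} (hD : ∀ x, ‖f x‖ ≤ D) (x : ℝ) :
    IntegrableOn (fun y => E y * (J y - J x) * R y * f y) (Ioi x) ∧
    ∫ y in Ioi x, E y * (J y - J x) * R y * f y
      = (∫ y in Ioi x, E y * J y * R y * f y) - J x * ∫ y in Ioi x, E y * R y * f y := by
  have h1 := tail_integrable hR hE hEb hf hD x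
  have h2 := tail_integrable (E := fun y => E y * J y) hR (hE.mul hJ) (EJ_bdd hEb hK) hf hD x
  have e : (fun y => E y * (J y - J x) * R y * f y)
      = fun y => E y * J y * R y * f y - J x * (E y * R y * f y) := by ext y; ring
  rw [e, ← integral_const_mul, ← integral_sub h2 (h1.const_mul _)]
  exact ⟨h2.sub (h1.const_mul _), rfl⟩

lemma volt_cont (hR : Integrable R) (hE : Continuous E) (hJ : Continuous J)
    (hEb : ∀ x, ∃ b, ∀ y, x ≤ y → ‖E y‖ ≤ b)
    (hK : ∀ x y, x ≤ y → ‖E y * (J y - J x)‖ ≤ κ) {f : ℝ → ℂ}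
    (hf : Continuous f) {D : ℝ} (hD : ∀ x, ‖f x‖ ≤ D) :
    Continuous (fun x => ∫ y in Ioi x, E y * (J y - J x) * R y * f y) := by
  have h1 := tail_integrable hR hE hEb hf hD
  have h2 := tail_integrable (E := fun y => E y * J y) hR (hE.mul hJ) (EJ_bdd hEb hK) hf hD
  have c1 := ACI.continuous_of (fun a b hab => ACI.of_tail h1 (a := a) (b := b) hab)
  have c2 := ACI.continuous_of (fun a b hab => ACI.of_tail h2 (a := a) (b := b) hab)
  refine (c2.sub (hJ.mul c1)).congr fun x => ?_
  exact (volt_split hR hE hJ hEb hK hf hD x).2.symm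

lemma volterra_exists (hR : Integrable R) (hE : Continuous E) (hJ : Continuous J)
    (hEb : ∀ x, ∃ b, ∀ y, x ≤ y → ‖E y‖ ≤ b) (hκ : 0 < κ)
    (hK : ∀ x y, x ≤ y → ‖E y * (J y - J x)‖ ≤ κ) :
    ∃ (f : ℝ → ℂ) (D : ℝ), Continuous f ∧ (∀ x, ‖f x‖ ≤ D) ∧
      ∀ x, f x = 1 + ∫ y in Ioi x, E y * (J y - J x) * R y * f y := by
  set M : ℝ := 2 * κ with hMdef
  have hM : 0 < M := by positivity
  obtain ⟨hwc, hw⟩ := weight_bound hR hM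
  set wt : ℝ → ℝ := fun x => Real.exp (M * ∫ y in Ioi x, ‖R y‖) with hwt
  have hwpos : ∀ x, 0 < wt x := fun x => Real.exp_pos _
  have hw1 : ∀ x, 1 ≤ wt x := fun x => by
    apply Real.one_le_exp
    exact mul_nonneg hM.le (integral_nonneg fun _ => norm_nonneg _)
  have hwle : ∀ x, wt x ≤ Real.exp (M * ∫ y, ‖R y‖) := fun x => by
    apply Real.exp_le_exp.2
    refine mul_le_mul_of_nonneg_left ?_ hM.le
    exact setIntegral_le_integral hR.norm (Eventually.of_forall fun _ => norm_nonneg _)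
  let ff : BoundedContinuousFunction ℝ ℂ → ℝ → ℂ := fun g x => (wt x : ℂ) * g x
  have hffc : ∀ g, Continuous (ff g) := fun g =>
    (Complex.continuous_ofReal.comp hwc).mul g.continuous
  have hffb : ∀ g x, ‖ff g x‖ ≤ wt x * ‖g‖ := fun g x => by
    simp only [ff, norm_mul, Complex.norm_real, Real.norm_of_nonneg (hwpos x).le]
    exact mul_le_mul_of_nonneg_left (g.norm_coe_le_norm x) (hwpos x).le
  have hffD : ∀ g x, ‖ff g x‖ ≤ Real.exp (M * ∫ y, ‖R y‖) * ‖g‖ := fun g x =>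
    (hffb g x).trans (mul_le_mul_of_nonneg_right (hwle x) (norm_nonneg _))
  let L : BoundedContinuousFunction ℝ ℂ → ℝ → ℂ := fun g x =>
    ∫ y in Ioi x, E y * (J y - J x) * R y * ff g y
  have hLc : ∀ g, Continuous (L g) := fun g => volt_cont hR hE hJ hEb hK (hffc g) (hffD g)
  have hLb : ∀ g x, ‖L g x‖ ≤ wt x * (‖g‖ / 2) := by
    intro g x
    have h1 : ‖L g x‖ ≤ ∫ y in Ioi x, κ * ‖g‖ * (‖R y‖ * wt y) := by
      apply norm_integral_le_of_norm_le ((hw x).1.const_mul _)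
      refine (ae_restrict_iff' measurableSet_Ioi).2 (Eventually.of_forall fun y hy => ?_)
      rw [norm_mul, norm_mul]
      calc _ ≤ κ * ‖R y‖ * (wt y * ‖g‖) := by
            gcongr
            · exact hK x y (le_of_lt hy)
            · exact hffb g y
        _ = _ := by ring
    rw [integral_const_mul] at h1
    refine h1.trans ?_
    calc _ ≤ κ * ‖g‖ * (wt x / M) :=
          mul_le_mul_of_nonneg_left (hw x).2 (by positivity)
      _ = _ := by rw [hMdef]; field_simp
  have hLsub : ∀ g₁ g₂ x, L g₁ x - L g₂ x = L (g₁ - g₂) x := by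
    intro g₁ g₂ x
    simp only [L]
    rw [← integral_sub (volt_split hR hE hJ hEb hK (hffc g₁) (hffD g₁) x).1
      (volt_split hR hE hJ hEb hK (hffc g₂) (hffD g₂) x).1]
    congr 1; ext y
    simp only [ff, BoundedContinuousFunction.coe_sub, Pi.sub_apply]
    ring
  have hwcc : Continuous (fun x => ((wt x)⁻¹ : ℝ)) := hwc.inv₀ fun x => (hwpos x).ne'
  let T : BoundedContinuousFunction ℝ ℂ → BoundedContinuousFunction ℝ ℂ := fun g =>
    BoundedContinuousFunction.ofNormedAddCommGroup
      (fun x => (((wt x)⁻¹ : ℝ) : ℂ) * (1 + L g x))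
      ((Complex.continuous_ofReal.comp hwcc).mul (continuous_const.add (hLc g))) (1 + ‖g‖ / 2) (by
        intro x
        rw [norm_mul, Complex.norm_real, Real.norm_of_nonneg (inv_pos.2 (hwpos x)).le,
          inv_mul_le_iff₀ (hwpos x)]
        refine (norm_add_le _ _).trans ?_
        rw [norm_one, mul_add, mul_one]
        exact add_le_add (hw1 x) (hLb g x))
  have hT : ∀ g x, T g x = (((wt x)⁻¹ : ℝ) : ℂ) * (1 + L g x) := fun g x => rfl
  have hcon : ContractingWith (1/2 : NNReal) T := by
    refine ⟨by rw [← NNReal.coe_lt_coe]; norm_num, ?_⟩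
    apply LipschitzWith.of_dist_le_mul
    intro g₁ g₂
    rw [BoundedContinuousFunction.dist_le (by positivity)]
    intro x
    rw [dist_eq_norm, hT, hT, ← mul_sub, add_sub_add_left_eq_sub, hLsub, norm_mul,
      Complex.norm_real, Real.norm_of_nonneg (inv_pos.2 (hwpos x)).le,
          inv_mul_le_iff₀ (hwpos x), dist_eq_norm]
    refine (hLb _ x).trans (le_of_eq ?_)
    push_cast
    ring
  have hfix := hcon.fixedPoint_isFixedPt
  set g := ContractingWith.fixedPoint T hcon
  refine ⟨ff g, _, hffc g, hffD g, fun x => ?_⟩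
  have h1 : T g x = g x := by rw [hfix]
  rw [hT] at h1
  simp only [ff] 
  rw [← h1, ← mul_assoc, ← Complex.ofReal_mul, mul_inv_cancel₀ (hwpos x).ne']
  simp [L, ff]

end volt

/-- The abstract Volterra construction of the Jost-type solution. -/
lemma volterra_sol {w P R : ℝ → ℂ} {c B : ℝ} (hw : Continuous w) (hP : Continuous P)
    (hR : Integrable R) (hc : 0 < c) (hwc : ∀ x, c ≤ (w x).re) (hB : ∀ x, ‖P x‖ ≤ B) :
    ∃ (f h : ℝ → ℂ) (D : ℝ), Continuous f ∧ (∀ x, ‖f x‖ ≤ D) ∧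
      (∀ x, HasDerivAt f (P x * h x) x) ∧ Continuous h ∧
      (∀ a b, a ≤ b → ACI h (fun x => 2 * w x * h x + R x * f x) a b) ∧
      (∀ x, ‖f x - 1‖ ≤ D * ∫ y in Ioi x, ‖R y‖) ∧
      (∀ x, ‖h x‖ ≤ D * ∫ y in Ioi x, ‖R y‖) := by
  set W : ℝ → ℂ := fun x => ∫ t in (0:ℝ)..x, w t with hWdef
  have hWd : ∀ x, HasDerivAt W (w x) x := fun x => (hw.integral_hasStrictDerivAt 0 x).hasDerivAt
  have hWc : Continuous W := continuous_iff_continuousAt.2 fun x => (hWd x).continuousAt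
  have hB0 : 0 ≤ B := (norm_nonneg _).trans (hB 0)
  have hWre : ∀ x y, x ≤ y → c * (y - x) ≤ (W y - W x).re := by
    intro x y hxy
    have e : W y - W x = ∫ t in x..y, w t :=
      intervalIntegral.integral_interval_sub_left (hw.intervalIntegrable _ _)
        (hw.intervalIntegrable _ _)
    have e2 : (∫ t in x..y, w t).re = ∫ t in x..y, (w t).re := by
      have := Complex.reCLM.intervalIntegral_comp_comm (hw.intervalIntegrable (μ := volume) x y)
      simpa using this.symm
    rw [e, e2]
    have : ∫ t in x..y, c = c * (y - x) := by
      rw [intervalIntegral.integral_const, smul_eq_mul]; ring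
    rw [← this]
    apply intervalIntegral.integral_mono_on hxy
    · simp
    · exact (Complex.continuous_re.comp hw).intervalIntegrable _ _
    · exact fun t _ => hwc t
  set E : ℝ → ℂ := fun x => cexp (-2 * W x) with hEdef
  have hEc : Continuous E := by simp only [hEdef]; fun_prop
  have hratio : ∀ x y, x ≤ y → ‖cexp (2 * W x) * E y‖ ≤ Real.exp (-2 * c * (y - x)) := by
    intro x y hxy
    rw [hEdef]
    simp only
    rw [← Complex.exp_add, Complex.norm_exp]
    apply Real.exp_le_exp.2
    have := hWre x y hxy
    have e : (2 * W x + -2 * W y).re = -2 * (W y - W x).re := by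
      simp; ring
    rw [e]; linarith
  have hratio1 : ∀ x y, x ≤ y → ‖cexp (2 * W x) * E y‖ ≤ 1 := fun x y hxy =>
    (hratio x y hxy).trans (Real.exp_le_one_iff.2 (by nlinarith))
  have hEinv : ∀ x, cexp (-2 * W x) * cexp (2 * W x) = 1 := fun x => by
    rw [← Complex.exp_add]; simp
  have hEb : ∀ x, ∃ b, ∀ y, x ≤ y → ‖E y‖ ≤ b := by
    intro x
    refine ⟨‖cexp (-2 * W x)‖, fun y hxy => ?_⟩
    calc ‖E y‖ = ‖cexp (-2 * W x) * (cexp (2 * W x) * E y)‖ := by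
          rw [← mul_assoc, hEinv, one_mul]
      _ ≤ _ := by
        rw [norm_mul]
        exact mul_le_of_le_one_right (norm_nonneg _) (hratio1 x y hxy)
  set J : ℝ → ℂ := fun x => ∫ t in (0:ℝ)..x, cexp (2 * W t) * P t with hJdef
  have hJ'c : Continuous (fun t => cexp (2 * W t) * P t) := by fun_prop
  have hJd : ∀ x, HasDerivAt J (cexp (2 * W x) * P x) x := fun x =>
    (hJ'c.integral_hasStrictDerivAt 0 x).hasDerivAt
  have hJc : Continuous J := continuous_iff_continuousAt.2 fun x => (hJd x).continuousAt
  set κ : ℝ := B / (2 * c) + 1 with hκdef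
  have hκ : 0 < κ := by positivity
  have hK : ∀ x y, x ≤ y → ‖E y * (J y - J x)‖ ≤ κ := by
    intro x y hxy
    have e : J y - J x = ∫ t in x..y, cexp (2 * W t) * P t :=
      intervalIntegral.integral_interval_sub_left (hJ'c.intervalIntegrable _ _)
        (hJ'c.intervalIntegrable _ _)
    rw [e, ← intervalIntegral.integral_const_mul]
    have hd : ∀ t ∈ uIcc x y, HasDerivAt (fun t => B / (2 * c) * Real.exp (-2 * c * (y - t)))
        (B * Real.exp (-2 * c * (y - t))) t := by
      intro t _
      have h1 : HasDerivAt (fun t => -2 * c * (y - t)) (2 * c) t := by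
        have := ((hasDerivAt_id t).const_sub y).const_mul (-2 * c)
        exact this.congr_deriv (by ring)
      have := h1.exp.const_mul (B / (2 * c))
      exact this.congr_deriv (by field_simp)
    have hci : Continuous (fun t => B * Real.exp (-2 * c * (y - t))) := by fun_prop
    have h2 : ‖∫ t in x..y, E y * (cexp (2 * W t) * P t)‖
        ≤ ∫ t in x..y, B * Real.exp (-2 * c * (y - t)) := by
      apply intervalIntegral.norm_integral_le_of_norm_le hxy _ (hci.intervalIntegrable _ _)
      refine Eventually.of_forall fun t ht => ?_
      calc ‖E y * (cexp (2 * W t) * P t)‖ = ‖P t‖ * ‖cexp (2 * W t) * E y‖ := by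
            rw [← norm_mul]; congr 1; ring
        _ ≤ _ := mul_le_mul (hB t) (hratio t y ht.2) (norm_nonneg _) hB0
    rw [intervalIntegral.integral_eq_sub_of_hasDerivAt hd (hci.intervalIntegrable _ _)] at h2
    refine h2.trans ?_
    have h3 : 0 ≤ B / (2 * c) * Real.exp (-2 * c * (y - x)) := by positivity
    simp only [sub_self, mul_zero, Real.exp_zero, mul_one]
    rw [hκdef]; linarith
  obtain ⟨f, D, hfc, hfD, hfeq⟩ := volterra_exists hR hEc hJc hEb hκ hK
  have hD0 : 0 ≤ D := (norm_nonneg _).trans (hfD 0)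
  have hti := tail_integrable hR hEc hEb hfc hfD
  have htj := tail_integrable (E := fun y => E y * J y) hR (hEc.mul hJc) (EJ_bdd hEb hK) hfc hfD
  set A : ℝ → ℂ := fun x => ∫ y in Ioi x, E y * R y * f y with hAdef
  have hA : ∀ a b, a ≤ b → ACI A (fun x => -(E x * R x * f x)) a b :=
    fun a b hab => ACI.of_tail hti hab
  have hB' : ∀ a b, a ≤ b → ACI (fun x => ∫ y in Ioi x, E y * J y * R y * f y)
    (fun x => -(E x * J x * R x * f x)) a b := fun a b hab => ACI.of_tail htj hab
  have hAc : Continuous A := ACI.continuous_of hA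
  set h : ℝ → ℂ := fun x => -(cexp (2 * W x) * A x) with hhdef
  have hhc : Continuous h := by simp only [hhdef]; fun_prop
  have hPh : Continuous (fun x => P x * h x) := hP.mul hhc
  -- f is a primitive of P h
  have hfint : ∀ a b, a ≤ b → f b - f a = ∫ t in a..b, P t * h t := by
    intro a b hab
    have hJA := (ACI.of_deriv hJd hJ'c a b).mul (hA a b hab) hab
    have e1 := hJA.eq b ⟨hab, le_rfl⟩
    have e2 := (hB' a b hab).eq b ⟨hab, le_rfl⟩
    have e3 := (volt_split hR hEc hJc hEb hK hfc hfD a).2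
    have e4 := (volt_split hR hEc hJc hEb hK hfc hfD b).2
    have e5 : f b - f a = (∫ t in a..b, -(E t * J t * R t * f t)) -
        ∫ t in a..b, (cexp (2 * W t) * P t * A t + J t * -(E t * R t * f t)) := by
      rw [hfeq b, hfeq a, e3, e4, ← e1, ← e2]
      simp only [hAdef]
      ring
    rw [e5, ← intervalIntegral.integral_sub (hB' a b hab).int hJA.int]
    congr 1; ext t
    simp only [hhdef]; ring
  have hfd : ∀ x, HasDerivAt f (P x * h x) x := by
    intro x
    have h1 : HasDerivAt (fun y => f (x - 1) + ∫ t in (x - 1)..y, P t * h t) (P x * h x) x :=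
      ((hPh.integral_hasStrictDerivAt (x - 1) x).hasDerivAt).const_add _
    apply h1.congr_of_eventuallyEq
    filter_upwards [eventually_ge_nhds (show x - 1 < x by linarith)] with y hy
    rw [← hfint _ _ hy]; ring
  have hε : ∀ x, IntegrableOn (fun y => ‖R y‖) (Ioi x) := fun x => hR.norm.integrableOn
  have hε0 : ∀ x, 0 ≤ ∫ y in Ioi x, ‖R y‖ := fun x => integral_nonneg fun _ => norm_nonneg _
  refine ⟨f, h, (κ + 1) * D, hfc, fun x => (hfD x).trans (by nlinarith), hfd, hhc, ?_, ?_, ?_⟩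
  · intro a b hab
    have hed : ∀ x, HasDerivAt (fun x => -cexp (2 * W x)) (-(cexp (2 * W x) * (2 * w x))) x :=
      fun x => (((hWd x).const_mul 2).cexp).neg
    have hm := (ACI.of_deriv hed (by fun_prop) a b).mul (hA a b hab) hab
    have ee : (fun t => -(cexp (2 * W t) * (2 * w t)) * A t
        + -cexp (2 * W t) * -(E t * R t * f t)) = fun x => 2 * w x * h x + R x * f x := by
      ext t
      have := hEinv t
      simp only [hhdef, hEdef]
      linear_combination (R t * f t) * this
    have eh : (fun t => -cexp (2 * W t) * A t) = h := by ext t; simp only [hhdef]; ring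
    rw [ee, eh] at hm
    exact hm
  · intro x
    have e : f x - 1 = ∫ y in Ioi x, E y * (J y - J x) * R y * f y := by
      rw [hfeq x]
      simp
    have : ‖f x - 1‖ ≤ ∫ y in Ioi x, (κ * D) * ‖R y‖ := by
      rw [e]
      apply norm_integral_le_of_norm_le ((hε x).const_mul _)
      refine (ae_restrict_iff' measurableSet_Ioi).2 (Eventually.of_forall fun y hy => ?_)
      rw [norm_mul, norm_mul]
      calc _ ≤ κ * ‖R y‖ * D := by
            gcongr
            · exact hK x y (le_of_lt hy)
            · exact hfD y
        _ = _ := by ring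
    rw [integral_const_mul] at this
    refine this.trans ?_
    exact mul_le_mul_of_nonneg_right (by nlinarith) (hε0 x)
  · intro x
    have e : h x = -∫ y in Ioi x, cexp (2 * W x) * (E y * R y * f y) := by
      rw [integral_const_mul]
    have : ‖h x‖ ≤ ∫ y in Ioi x, D * ‖R y‖ := by
      rw [e, norm_neg]
      apply norm_integral_le_of_norm_le ((hε x).const_mul _)
      refine (ae_restrict_iff' measurableSet_Ioi).2 (Eventually.of_forall fun y hy => ?_)
      rw [← mul_assoc, ← mul_assoc, norm_mul, norm_mul]
      calc _ ≤ 1 * ‖R y‖ * D := by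
            gcongr
            · exact hratio1 x y (le_of_lt hy)
            · exact hfD y
        _ = _ := by ring
    rw [integral_const_mul] at this
    refine this.trans ?_
    exact mul_le_mul_of_nonneg_right (by nlinarith) (hε0 x)

lemma pos_lb {φ : ℝ → ℝ} {a L : ℝ} (hc : ContinuousOn φ (Ici a)) (hpos : ∀ x, a ≤ x → 0 < φ x)
    (hL : 0 < L) (hlim : Tendsto φ atTop (nhds L)) :
    (∃ c, 0 < c ∧ ∀ x, a ≤ x → c ≤ φ x) ∧ ∃ C, 0 < C ∧ ∀ x, a ≤ x → φ x ≤ C := by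
  have h1 : ∀ᶠ x in atTop, φ x ∈ Ioo (L / 2) (2 * L) :=
    hlim (Ioo_mem_nhds (by linarith) (by linarith))
  obtain ⟨N, hN⟩ := eventually_atTop.1 h1
  have hcN : ContinuousOn φ (Icc a (max a N)) := hc.mono Icc_subset_Ici_self
  have hne : (Icc a (max a N)).Nonempty := ⟨a, le_rfl, le_max_left _ _⟩
  obtain ⟨x₁, hx₁, hmin⟩ := isCompact_Icc.exists_isMinOn hne hcN
  obtain ⟨x₂, hx₂, hmax⟩ := isCompact_Icc.exists_isMaxOn hne hcN
  constructor
  · refine ⟨min (φ x₁) (L / 2), lt_min (hpos _ hx₁.1) (by linarith), fun x hx => ?_⟩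
    by_cases hxN : x ≤ max a N
    · exact (min_le_left _ _).trans (hmin ⟨hx, hxN⟩)
    · push Not at hxN
      exact (min_le_right _ _).trans (hN x ((le_max_right a N).trans hxN.le)).1.le
  · refine ⟨max (φ x₂) (2 * L), lt_max_of_lt_right (by linarith), fun x hx => ?_⟩
    by_cases hxN : x ≤ max a N
    · exact le_trans (hmax ⟨hx, hxN⟩) (le_max_left _ _)
    · push Not at hxN
      exact le_trans (hN x ((le_max_right a N).trans hxN.le)).2.le (le_max_right _ _)

lemma half_re_pos {w : ℂ} (hw : w ∈ slitPlane) : 0 < (w ^ (1 / 2 : ℂ)).re := by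
  have h0 : w ≠ 0 := slitPlane_ne_zero hw
  rw [cpow_def_of_ne_zero h0, Complex.exp_re]
  apply mul_pos (Real.exp_pos _)
  have e : (Complex.log w * (1 / 2)).im = w.arg / 2 := by
    have : Complex.log w * (1 / 2) = Complex.log w / (2:ℝ) := by push_cast; ring
    rw [this, Complex.div_ofReal_im, Complex.log_im]
  rw [e]
  apply Real.cos_pos_of_mem_Ioo
  have h1 := Complex.neg_pi_lt_arg w
  have h2 : w.arg < Real.pi :=
    lt_of_le_of_ne (Complex.arg_le_pi w) (Complex.mem_slitPlane_iff_arg.1 hw).1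
  constructor <;> linarith

lemma half_sq (w : ℂ) : (w ^ (1 / 2 : ℂ)) ^ 2 = w := by
  have := Complex.cpow_nat_inv_pow w (n := 2) (by norm_num)
  rw [one_div]
  exact_mod_cast this

lemma slit_div {w : ℂ} (hw : w ∈ slitPlane) {r : ℝ} (hr : 0 < r) : w / (r : ℂ) ∈ slitPlane := by
  rw [Complex.mem_slitPlane_iff] at hw ⊢
  rw [Complex.div_ofReal_re, Complex.div_ofReal_im]
  rcases hw with h | h
  · exact Or.inl (div_pos h hr)
  · exact Or.inr (div_ne_zero h hr.ne')

lemma slit_mul {w : ℂ} (hw : w ∈ slitPlane) {r : ℝ} (hr : 0 < r) : (r : ℂ) * w ∈ slitPlane := by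
  have := slit_div hw (inv_pos.2 hr)
  rw [Complex.ofReal_inv, div_inv_eq_mul, mul_comm] at this
  exact this

lemma half_mul {w : ℂ} (hw : w ∈ slitPlane) {r : ℝ} (hr : 0 < r) :
    ((r : ℂ) * w) ^ (1 / 2 : ℂ) = r * (w / r) ^ (1 / 2 : ℂ) := by
  have h1 := half_re_pos (slit_mul hw hr)
  have h2 := half_re_pos (slit_div hw hr)
  have h3 : (r : ℂ) ≠ 0 := by exact_mod_cast hr.ne'
  have e : (((r : ℂ) * w) ^ (1 / 2 : ℂ)) ^ 2 = (r * (w / r) ^ (1 / 2 : ℂ)) ^ 2 := by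
    rw [mul_pow, half_sq, half_sq]; field_simp
  rcases sq_eq_sq_iff_eq_or_eq_neg.1 e with h | h
  · exact h
  · exfalso
    have := congrArg Complex.re h
    rw [Complex.neg_re, Complex.re_ofReal_mul] at this
    have := mul_pos hr h2
    linarith

lemma slit_of_small {z : ℂ} (hz : ∀ t : ℝ, 0 ≤ t → (t : ℂ) ≠ z) {s : ℝ} (hs : |s| ≤ ‖z‖ / 2) :
    (s : ℂ) - z ∈ slitPlane := by
  rw [Complex.mem_slitPlane_iff]
  by_cases him : z.im = 0
  · left
    have hzr : ((z.re : ℝ) : ℂ) = z := by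
      apply Complex.ext <;> simp [him]
    have hneg : z.re < 0 := by
      by_contra hcon
      exact hz z.re (not_lt.1 hcon) hzr
    have hn : ‖z‖ = -z.re := by
      rw [← hzr, Complex.norm_real, Real.norm_eq_abs, abs_of_neg hneg]; simp
    rw [hn] at hs
    have := (abs_le.1 hs).1
    simp only [Complex.sub_re, Complex.ofReal_re]
    linarith
  · right
    simp [him]

lemma half_deriv {w : ℂ} (hw : w ∈ slitPlane) :
    HasDerivAt (fun w : ℂ => w ^ (1 / 2 : ℂ)) ((2 * w ^ (1 / 2 : ℂ))⁻¹) w := by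
  have h := (hasDerivAt_id w).cpow_const (c := (1 / 2 : ℂ)) ?_
  · refine h.congr_deriv ?_
    have h0 : w ≠ 0 := slitPlane_ne_zero hw
    have h1 : w ^ (1 / 2 : ℂ) ≠ 0 := by
      intro h; have := half_re_pos hw; rw [h] at this; simp at this
    have h2 := half_sq w
    simp only [id, mul_one]
    rw [Complex.cpow_sub _ _ h0, Complex.cpow_one]
    field_simp
    linear_combination h2
  · exact hw

/-- Complex-valued version of absolute continuity. -/
lemma ACI.ofReal {u u' : ℝ → ℝ} {a b : ℝ} (h : ACI u u' a b) :
    ACI (fun x => (u x : ℂ)) (fun x => (u' x : ℂ)) a b := by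
  refine ⟨⟨h.int.1.ofReal, h.int.2.ofReal⟩, fun x hx => ?_⟩
  rw [intervalIntegral.integral_ofReal, ← h.eq x hx]
  push_cast; rfl

lemma re_primitive {w : ℝ → ℂ} (hw : Continuous w) {c : ℝ} (hwc : ∀ x, c ≤ (w x).re) {x : ℝ}
    (hx : 0 ≤ x) : c * x ≤ (∫ t in (0:ℝ)..x, w t).re := by
  have e2 : (∫ t in (0:ℝ)..x, w t).re = ∫ t in (0:ℝ)..x, (w t).re := by
    have := Complex.reCLM.intervalIntegral_comp_comm (hw.intervalIntegrable (μ := volume) 0 x)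
    simpa using this.symm
  rw [e2]
  have : ∫ t in (0:ℝ)..x, c = c * x := by
    rw [intervalIntegral.integral_const, smul_eq_mul]; ring
  rw [← this]
  apply intervalIntegral.integral_mono_on hx
  · simp
  · exact (Complex.continuous_re.comp hw).intervalIntegrable _ _
  · exact fun t _ => hwc t

lemma tail_bound {q q' : ℝ → ℝ} {x₀ L : ℝ}
    (hac : ∀ a b, x₀ ≤ a → a ≤ b → ACI q q' a b) (hint : IntegrableOn q' (Ioi x₀))
    (hlim : Tendsto q atTop (nhds L)) {x : ℝ} (hx : x₀ ≤ x) :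
    |q x - L| ≤ ∫ y in Ioi x, |q' y| := by
  have hi : IntegrableOn q' (Ioi x) := hint.mono_set (Ioi_subset_Ioi hx)
  have ht := intervalIntegral_tendsto_integral_Ioi x hi tendsto_id
  have ht2 : Tendsto (fun y => q y - q x) atTop (nhds (L - q x)) := hlim.sub_const _
  have e : L - q x = ∫ y in Ioi x, q' y := by
    refine tendsto_nhds_unique (ht2.congr' ?_) ht
    filter_upwards [eventually_ge_atTop x] with y hy
    exact (hac x y hx hy).eq y ⟨hy, le_rfl⟩
  rw [abs_sub_comm, e]
  exact norm_integral_le_integral_norm (μ := volume.restrict (Ioi x)) q'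

section concrete
variable {p p' q q' : ℝ → ℝ} {p₀ x₀ : ℝ}

lemma PQData.p_aci (h : PQData p p' q q' p₀ x₀) (a b : ℝ) (ha : 0 ≤ a) (hab : a ≤ b) :
    ACI p p' a b := by
  have h0 : ACI p p' 0 b := by
    refine ⟨(intervalIntegrable_iff_integrableOn_Ioc_of_le (ha.trans hab)).2
      (h.p'_int.mono_set Ioc_subset_Ioi_self), fun x hx => ?_⟩
    rw [h.p_ac x hx.1]; ring
  exact ⟨h0.int' ha hab le_rfl, fun x hx => h0.eq' ha hx.1 hx.2⟩

lemma PQData.q_aci (h : PQData p p' q q' p₀ x₀) (a b : ℝ) (ha : x₀ ≤ a) (hab : a ≤ b) :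
    ACI q q' a b := by
  have h0 : ACI q q' x₀ b := by
    refine ⟨(intervalIntegrable_iff_integrableOn_Ioc_of_le (ha.trans hab)).2
      (h.q'_int.mono_set Ioc_subset_Ioi_self), fun x hx => ?_⟩
    rw [h.q_ac x hx.1]; ring
  exact ⟨h0.int' ha hab le_rfl, fun x hx => h0.eq' ha hx.1 hx.2⟩

lemma contOn_Ici {u u' : ℝ → ℝ} {a : ℝ} (h : ∀ b, a ≤ b → ACI u u' a b) :
    ContinuousOn u (Ici a) := by
  intro x hx
  have hx' : a ≤ x := hx
  have := ((h (x + 1) (by linarith)).cont (by linarith)) x ⟨hx, by linarith⟩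
  apply this.mono_of_mem_nhdsWithin
  have h2 : Ici a ∩ Iio (x + 1) ∈ nhdsWithin x (Ici a) :=
    inter_mem_nhdsWithin _ (Iio_mem_nhds (by linarith))
  exact mem_of_superset h2 fun y hy => ⟨hy.1, (le_of_lt hy.2)⟩

lemma PQData.p_cont (h : PQData p p' q q' p₀ x₀) : ContinuousOn p (Ici 0) :=
  contOn_Ici fun b hb => h.p_aci 0 b le_rfl hb

lemma PQData.q_cont (h : PQData p p' q q' p₀ x₀) : ContinuousOn q (Ici x₀) :=
  contOn_Ici fun b hb => h.q_aci x₀ b le_rfl hb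

lemma PQData.q_intOn (h : PQData p p' q q' p₀ x₀) {x₁ : ℝ} (hx₁ : x₀ ≤ x₁) :
    IntegrableOn q (Ioc 0 x₁) := by
  have h1 : IntegrableOn q (Ioc 0 x₀) := (integrableOn_Ioc_iff_integrableOn_Ioo).2 h.q_int
  have h2 : IntegrableOn q (Icc x₀ x₁) :=
    (h.q_cont.mono Icc_subset_Ici_self).integrableOn_Icc
  have := h1.union (h2.mono_set Ioc_subset_Icc_self)
  rwa [Ioc_union_Ioc_eq_Ioc h.hx₀ hx₁] at this

lemma PQData.omg_int (h : PQData p p' q q' p₀ x₀) (z : ℂ) {x₁ : ℝ} (hx₁ : x₀ ≤ x₁) :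
    IntervalIntegrable (omg p q z) volume 0 x₁ := by
  have h0 : 0 ≤ x₁ := h.hx₀.trans hx₁
  rw [intervalIntegrable_iff_integrableOn_Ioc_of_le h0]
  have hpc : ContinuousOn (fun x => ((p x : ℂ))⁻¹) (Icc 0 x₁) := by
    apply ContinuousOn.inv₀
    · exact Complex.continuous_ofReal.comp_continuousOn (h.p_cont.mono Icc_subset_Ici_self)
    · intro x hx
      exact_mod_cast (h.p_pos x hx.1).ne'
  have hq : IntegrableOn (fun x => (q x : ℂ) - z) (Ioc 0 x₁) := by
    refine Integrable.sub (h.q_intOn hx₁).ofReal ?_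
    exact integrableOn_const (by simp)
  have hw : IntegrableOn (fun x => ((q x : ℂ) - z) / (p x : ℂ)) (Ioc 0 x₁) := by
    have := (intervalIntegrable_iff_integrableOn_Ioc_of_le h0).2 hq
    have := this.mul_continuousOn (g := fun x => ((p x : ℂ))⁻¹) (by rwa [uIcc_of_le h0])
    exact (intervalIntegrable_iff_integrableOn_Ioc_of_le h0).1 this
  have hone : IntegrableOn (fun _ : ℝ => (1:ℝ)) (Ioc 0 x₁) := integrableOn_const (by simp)
  refine Integrable.mono' (hone.add hw.norm) ?_ ?_
  · exact (hw.aestronglyMeasurable.aemeasurable.pow_const (1 / 2 : ℂ)).aestronglyMeasurable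
  · refine Eventually.of_forall fun x => ?_
    have := half_sq (((q x : ℂ) - z) / (p x : ℂ))
    have h2 := congrArg norm this
    rw [norm_pow] at h2
    simp only [omg, Pi.add_apply]
    rw [← h2]
    nlinarith [norm_nonneg ((((q x : ℂ) - z) / (p x : ℂ)) ^ (1 / 2 : ℂ)),
      sq_nonneg (‖(((q x : ℂ) - z) / (p x : ℂ)) ^ (1 / 2 : ℂ)‖ - 1)]

/-- data about `s = p ω` on `[x₁,∞)`. -/
lemma PQData.s_data (h : PQData p p' q q' p₀ x₀)
    {z : ℂ} (hz : ∀ t : ℝ, 0 ≤ t → (t : ℂ) ≠ z)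
    {x₁ : ℝ} (hx₁ : x₀ ≤ x₁) (hx₁q : ∀ x : ℝ, x₁ ≤ x → |q x| ≤ ‖z‖ / 2) :
    ∃ (σ : ℝ → ℂ) (c m Mp C₁ C₂ : ℝ), 0 < c ∧ 0 < m ∧ 0 < Mp ∧ 0 ≤ C₁ ∧ 0 ≤ C₂ ∧
      (∀ x, 0 ≤ x → m ≤ p x) ∧ (∀ x, 0 ≤ x → p x ≤ Mp) ∧
      (∀ x, x₁ ≤ x → c ≤ (omg p q z x).re) ∧
      (∀ x, x₁ ≤ x → omg p q z x ^ 2 = ((q x : ℂ) - z) / p x) ∧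
      ContinuousOn (omg p q z) (Ici x₁) ∧
      IntegrableOn σ (Ioi x₁) ∧
      (∀ x, x₁ ≤ x → ‖σ x‖ ≤ C₁ * (|p' x| + |q' x|)) ∧
      (∀ a b, x₁ ≤ a → a ≤ b → ACI (fun x => (p x : ℂ) * omg p q z x) σ a b) ∧
      (∀ x, x₁ ≤ x → ‖omg p q z x - (-z / (p₀ : ℂ)) ^ (1 / 2 : ℂ)‖ ≤ C₂ * eps p' q' x) := by
  have hx₁0 : 0 ≤ x₁ := h.hx₀.trans hx₁
  obtain ⟨⟨m, hm, hmp⟩, ⟨Mp, hMp, hpM⟩⟩ := pos_lb h.p_cont (fun x hx => h.p_pos x hx) h.hp₀ h.p_lim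
  have hslit : ∀ x, x₁ ≤ x → (q x : ℂ) - z ∈ slitPlane := fun x hx =>
    slit_of_small hz (hx₁q x hx)
  have hslit0 : -z ∈ slitPlane := by
    have := slit_of_small hz (s := 0) (by rw [abs_zero]; positivity)
    simpa using this
  have hpp : ∀ x, x₁ ≤ x → 0 < p x := fun x hx => h.p_pos x (hx₁0.trans hx)
  have hpc : ContinuousOn p (Ici x₁) := h.p_cont.mono (Ici_subset_Ici.2 hx₁0)
  have hqc : ContinuousOn q (Ici x₁) := h.q_cont.mono (Ici_subset_Ici.2 hx₁)
  have hpc' : ContinuousOn (fun x => (p x : ℂ)) (Ici x₁) :=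
    Complex.continuous_ofReal.comp_continuousOn hpc
  have hqc' : ContinuousOn (fun x => (q x : ℂ) - z) (Ici x₁) :=
    (Complex.continuous_ofReal.comp_continuousOn hqc).sub continuousOn_const
  have hoc : ContinuousOn (omg p q z) (Ici x₁) := by
    apply ContinuousOn.cpow_const
    · exact hqc'.div hpc' fun x hx => by exact_mod_cast (hpp x hx).ne'
    · exact fun x hx => slit_div (hslit x hx) (hpp x hx)
  have hpos : ∀ x, x₁ ≤ x → 0 < (omg p q z x).re := fun x hx =>
    half_re_pos (slit_div (hslit x hx) (hpp x hx))
  set ω₀ : ℂ := (-z / (p₀ : ℂ)) ^ (1 / 2 : ℂ) with hω₀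
  have hω₀pos : 0 < ω₀.re := half_re_pos (slit_div hslit0 h.hp₀)
  have hp₀c : (p₀ : ℂ) ≠ 0 := by exact_mod_cast h.hp₀.ne'
  have holim : Tendsto (omg p q z) atTop (nhds ω₀) := by
    have h1 : Tendsto (fun x => ((q x : ℂ) - z) / (p x : ℂ)) atTop (nhds (-z / (p₀ : ℂ))) := by
      have hq0 : Tendsto (fun x => (q x : ℂ)) atTop (nhds ((0:ℝ) : ℂ)) :=
        (Complex.continuous_ofReal.tendsto _).comp h.q_lim
      have hp0 : Tendsto (fun x => (p x : ℂ)) atTop (nhds (p₀ : ℂ)) :=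
        (Complex.continuous_ofReal.tendsto _).comp h.p_lim
      have := (hq0.sub_const z).div hp0 hp₀c
      have e0 : (((0:ℝ) : ℂ) - z) / (p₀ : ℂ) = -z / (p₀ : ℂ) := by simp
      rw [e0] at this
      exact this
    exact (half_deriv (slit_div hslit0 h.hp₀)).continuousAt.tendsto.comp h1
  obtain ⟨⟨c, hc, hcω⟩, -⟩ := pos_lb (Complex.continuous_re.comp_continuousOn hoc) hpos hω₀pos
    ((Complex.continuous_re.tendsto _).comp holim)
  have hsq : ∀ x, omg p q z x ^ 2 = ((q x : ℂ) - z) / p x := fun x => half_sq _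
  set S : ℝ → ℂ := fun x => (p x : ℂ) * omg p q z x with hS
  have hSre : ∀ x, x₁ ≤ x → m * c ≤ (S x).re := fun x hx => by
    simp only [hS, Complex.re_ofReal_mul]
    have := hmp x (hx₁0.trans hx)
    have := hcω x hx
    simp only [Function.comp] at this
    exact mul_le_mul (by assumption) this hc.le (hpp x hx).le
  have hmc : 0 < m * c := mul_pos hm hc
  have hSn : ∀ x, x₁ ≤ x → m * c ≤ ‖S x‖ := fun x hx =>
    (hSre x hx).trans (Complex.re_le_norm _)
  have hS0 : ∀ x, x₁ ≤ x → S x ≠ 0 := fun x hx h0 => by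
    have := hSn x hx; rw [h0, norm_zero] at this; linarith
  have hSc : ContinuousOn S (Ici x₁) := hpc'.mul hoc
  have hSinvc : ContinuousOn (fun x => (2 * S x)⁻¹) (Ici x₁) :=
    (continuousOn_const.mul hSc).inv₀ fun x hx => mul_ne_zero two_ne_zero (hS0 x hx)
  have hSinv : ∀ x, x₁ ≤ x → ‖(2 * S x)⁻¹‖ ≤ (m * c)⁻¹ := fun x hx => by
    rw [norm_inv]
    apply inv_anti₀ hmc
    rw [norm_mul, Complex.norm_ofNat]
    linarith [hSn x hx]
  have hSeq : ∀ x, x₁ ≤ x → S x = ((p x : ℂ) * ((q x : ℂ) - z)) ^ (1 / 2 : ℂ) := fun x hx =>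
    (half_mul (hslit x hx) (hpp x hx)).symm
  set σ : ℝ → ℂ := fun x => (2 * S x)⁻¹ * ((p' x : ℂ) * ((q x : ℂ) - z) + (p x : ℂ) * (q' x : ℂ))
    with hσ
  have hqz : ∀ x, x₁ ≤ x → ‖(q x : ℂ) - z‖ ≤ 2 * ‖z‖ := fun x hx => by
    refine (norm_sub_le _ _).trans ?_
    rw [Complex.norm_real, Real.norm_eq_abs]
    have := hx₁q x hx
    have := norm_nonneg z
    linarith
  have hσb : ∀ x, x₁ ≤ x → ‖σ x‖ ≤ ((m * c)⁻¹ * (2 * ‖z‖ + Mp)) * (|p' x| + |q' x|) := by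
    intro x hx
    rw [hσ]
    simp only
    rw [norm_mul, mul_assoc]
    refine mul_le_mul (hSinv x hx) ?_ (norm_nonneg _) (by positivity)
    refine (norm_add_le _ _).trans ?_
    rw [norm_mul, norm_mul, Complex.norm_real, Complex.norm_real, Complex.norm_real,
      Real.norm_eq_abs, Real.norm_eq_abs, Real.norm_eq_abs, abs_of_pos (hpp x hx)]
    have h1 : |p' x| * ‖(q x : ℂ) - z‖ ≤ |p' x| * (2 * ‖z‖) := by gcongr; exact hqz x hx
    have h2 : p x * |q' x| ≤ Mp * |q' x| := by gcongr; exact hpM x (hx₁0.trans hx)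
    have h3 : 0 ≤ Mp * |p' x| := by positivity
    have h4 : 0 ≤ ‖z‖ * |q' x| := by positivity
    nlinarith
  have hp'i : IntegrableOn p' (Ioi x₁) := h.p'_int.mono_set (Ioi_subset_Ioi hx₁0)
  have hq'i : IntegrableOn q' (Ioi x₁) := h.q'_int.mono_set (Ioi_subset_Ioi hx₁)
  have hσi : IntegrableOn σ (Ioi x₁) := by
    have hd : IntegrableOn (fun x => ((m * c)⁻¹ * (2 * ‖z‖ + Mp)) * (|p' x| + |q' x|)) (Ioi x₁) :=
      (hp'i.abs.add hq'i.abs).const_mul _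
    refine Integrable.mono' hd ?_ ?_
    · refine AEStronglyMeasurable.mul ?_ (AEStronglyMeasurable.add
        (AEStronglyMeasurable.mul ?_ ?_) (AEStronglyMeasurable.mul ?_ ?_))
      · exact (hSinvc.mono Ioi_subset_Ici_self).aestronglyMeasurable measurableSet_Ioi
      · exact hp'i.ofReal.aestronglyMeasurable
      · exact (hqc'.mono Ioi_subset_Ici_self).aestronglyMeasurable measurableSet_Ioi
      · exact (hpc'.mono Ioi_subset_Ici_self).aestronglyMeasurable measurableSet_Ioi
      · exact hq'i.ofReal.aestronglyMeasurable
    · exact (ae_restrict_iff' measurableSet_Ioi).2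
        (Eventually.of_forall fun y hy => hσb y (le_of_lt hy))
  have hac : ∀ a b, x₁ ≤ a → a ≤ b → ACI S σ a b := by
    intro a b ha hab
    have hp := (h.p_aci a b (hx₁0.trans ha) hab).ofReal
    have hq0 := (h.q_aci a b (hx₁.trans ha) hab).ofReal
    have hq : ACI (fun x => (q x : ℂ) - z) (fun x => (q' x : ℂ)) a b :=
      ⟨hq0.int, fun x hx => by rw [← hq0.eq x hx]; ring⟩
    have hQ := hp.mul hq hab
    have hI : Icc a b ⊆ Ici x₁ := fun x hx => ha.trans hx.1
    have hcomp := hQ.comp hab (φ := fun w => w ^ (1 / 2 : ℂ))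
      (φ' := fun w => (2 * w ^ (1 / 2 : ℂ))⁻¹)
      (fun x hx => half_deriv (slit_mul (hslit x (hI hx)) (hpp x (hI hx))))
      ((hSinvc.mono hI).congr fun x hx => by simp only [hSeq x (hI hx)])
    have hσeq : ∀ t, a ≤ t → σ t = (2 * ((p t : ℂ) * ((q t : ℂ) - z)) ^ (1 / 2 : ℂ))⁻¹ *
        ((p' t : ℂ) * ((q t : ℂ) - z) + (p t : ℂ) * (q' t : ℂ)) := fun t ht => by
      rw [← hSeq t (ha.trans ht)]
    refine ⟨?_, fun x hx => ?_⟩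
    · refine (intervalIntegrable_iff_integrableOn_Ioc_of_le hab).2 (hσi.mono_set ?_)
      exact fun x hx => ha.trans_lt hx.1
    · rw [hSeq x (ha.trans hx.1), hSeq a ha]
      refine (hcomp.eq x hx).trans ?_
      apply intervalIntegral.integral_congr
      intro t ht
      rw [uIcc_of_le hx.1] at ht
      exact (hσeq t ht.1).symm
  refine ⟨σ, c, m, Mp, (m * c)⁻¹ * (2 * ‖z‖ + Mp), ω₀.re⁻¹ * (m⁻¹ + ‖z‖ * (m * p₀)⁻¹),
    hc, hm, hMp, by positivity, ?_, hmp, hpM, hcω, fun x _ => hsq x, hoc, hσi, hσb, hac, ?_⟩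
  · have := h.hp₀
    positivity
  · intro x hx
    have hp0 := hpp x hx
    have hpC : (p x : ℂ) ≠ 0 := by exact_mod_cast hp0.ne'
    have hsum : ω₀.re ≤ ‖omg p q z x + ω₀‖ := by
      refine le_trans ?_ (Complex.re_le_norm _)
      rw [Complex.add_re]
      linarith [hpos x hx]
    have hdiff : ‖omg p q z x - ω₀‖ * ‖omg p q z x + ω₀‖
        = ‖(q x : ℂ) / p x + z * ((p x : ℂ) - p₀) / (p x * p₀)‖ := by
      rw [← norm_mul]
      congr 1
      have e1 := hsq x
      have e2 : ω₀ ^ 2 = -z / (p₀ : ℂ) := half_sq _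
      calc (omg p q z x - ω₀) * (omg p q z x + ω₀) = omg p q z x ^ 2 - ω₀ ^ 2 := by ring
        _ = _ := by rw [e1, e2]; field_simp; ring
    have hp'x : IntegrableOn p' (Ioi x) := hp'i.mono_set (Ioi_subset_Ioi hx)
    have hq'x : IntegrableOn q' (Ioi x) := hq'i.mono_set (Ioi_subset_Ioi hx)
    have heps : eps p' q' x = (∫ y in Ioi x, |p' y|) + ∫ y in Ioi x, |q' y| :=
      integral_add hp'x.abs hq'x.abs
    have n1 : 0 ≤ ∫ y in Ioi x, |p' y| := integral_nonneg fun _ => abs_nonneg _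
    have n2 : 0 ≤ ∫ y in Ioi x, |q' y| := integral_nonneg fun _ => abs_nonneg _
    have b1 : |p x - p₀| ≤ eps p' q' x := by
      have := tail_bound h.p_aci h.p'_int h.p_lim (hx₁0.trans hx)
      linarith
    have b2 : |q x| ≤ eps p' q' x := by
      have := tail_bound h.q_aci h.q'_int h.q_lim (hx₁.trans hx)
      rw [sub_zero] at this
      linarith
    have hε0 : 0 ≤ eps p' q' x := (abs_nonneg _).trans b2
    have hmx := hmp x (hx₁0.trans hx)
    have b3 : ‖(q x : ℂ) / p x + z * ((p x : ℂ) - p₀) / (p x * p₀)‖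
        ≤ (m⁻¹ + ‖z‖ * (m * p₀)⁻¹) * eps p' q' x := by
      refine (norm_add_le _ _).trans ?_
      rw [norm_div, norm_div, norm_mul, norm_mul, ← Complex.ofReal_sub, Complex.norm_real,
        Complex.norm_real, Complex.norm_real, Complex.norm_real, Real.norm_eq_abs,
        Real.norm_eq_abs, Real.norm_eq_abs, Real.norm_eq_abs, abs_of_pos hp0, abs_of_pos h.hp₀,
        add_mul, div_eq_mul_inv, div_eq_mul_inv]
      have hp₀' := h.hp₀
      apply add_le_add
      · rw [mul_comm]
        exact mul_le_mul (inv_anti₀ hm hmx) b2 (abs_nonneg _) (by positivity)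
      · have : (p x * p₀)⁻¹ ≤ (m * p₀)⁻¹ := inv_anti₀ (by positivity) (by gcongr)
        calc ‖z‖ * |p x - p₀| * (p x * p₀)⁻¹ ≤ ‖z‖ * eps p' q' x * (m * p₀)⁻¹ := by
              gcongr
          _ = _ := by ring
    rw [← hdiff] at b3
    have b4 : ‖omg p q z x - ω₀‖ * ω₀.re ≤ (m⁻¹ + ‖z‖ * (m * p₀)⁻¹) * eps p' q' x :=
      (mul_le_mul_of_nonneg_left hsum (norm_nonneg _)).trans b3
    rw [mul_assoc, ← div_eq_inv_mul, le_div_iff₀ hω₀pos]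
    exact b4

end concrete

/-- existence of the modified Jost solution `θ(·,z)` of the Schrödinger
equation on `[0,∞)` with `|θ(x,z) − a(x,z)| ≤ C ε(x)|a(x,z)|` and
`|θ'(x,z) + √(−z/p₀) a(x,z)| ≤ C ε(x)|a(x,z)|` for `x ≥ x₁(z)`; if `Im z ≠ 0` then
`θ(·,z)` is square integrable on `(0,∞)`. -/
theorem statement8 (p p' q q' : ℝ → ℝ) (p₀ x₀ : ℝ)
    (hPQ : PQData p p' q q' p₀ x₀)
    (z : ℂ) (hz : ∀ t : ℝ, 0 ≤ t → (t : ℂ) ≠ z)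
    (x₁ : ℝ) (hx₁ : x₀ ≤ x₁) (hx₁q : ∀ x : ℝ, x₁ ≤ x → |q x| ≤ ‖z‖ / 2) :
    ∃ (θ θ' : ℝ → ℂ) (C : ℝ),
      IsSol p q z (Ici 0) θ θ' ∧
      (∀ x : ℝ, x₁ ≤ x →
        ‖θ x - aa p q z x‖ ≤ C * eps p' q' x * ‖aa p q z x‖) ∧
      (∀ x : ℝ, x₁ ≤ x →
        ‖θ' x + (-z / (p₀ : ℂ)) ^ (1 / 2 : ℂ) * aa p q z x‖
          ≤ C * eps p' q' x * ‖aa p q z x‖) ∧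
      (z.im ≠ 0 → IntegrableOn (fun x => ‖θ x‖ ^ 2) (Ioi (0:ℝ))) := by
  have hx₁0 : 0 ≤ x₁ := hPQ.hx₀.trans hx₁
  obtain ⟨σ, c, m, Mp, C₁, C₂, hc, hm, hMp, hC₁, hC₂, hmp, hpM, hcω, hsq, hoc, hσi, hσb, hac, hω₀⟩ :=
    hPQ.s_data hz hx₁ hx₁q
  -- extended coefficients
  set pt : ℝ → ℂ := fun x => (p (max x 0) : ℂ) with hpt
  have hptc : Continuous pt := by
    refine Complex.continuous_ofReal.comp ?_
    exact hPQ.p_cont.comp_continuous (by fun_prop) fun x => mem_Ici.2 (le_max_right _ _)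
  have hpteq : ∀ x, 0 ≤ x → pt x = p x := fun x hx => by simp only [hpt, max_eq_left hx]
  have hppos : ∀ x, 0 < p (max x 0) := fun x => hPQ.p_pos _ (le_max_right _ _)
  have hpt0 : ∀ x, pt x ≠ 0 := fun x => by
    simp only [hpt]; exact_mod_cast (hppos x).ne'
  set s : ℝ → ℂ := fun x => (p (max x x₁) : ℂ) * omg p q z (max x x₁) with hs
  have hseq : ∀ x, x₁ ≤ x → s x = p x * omg p q z x := fun x hx => by
    simp only [hs, max_eq_left hx]
  set σt : ℝ → ℂ := (Ioi x₁).indicator σ with hσt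
  have hσti : Integrable σt := (integrable_indicator_iff measurableSet_Ioi).2 hσi
  have hsac : ∀ a b, a ≤ b → ACI s σt a b := by
    intro a b _
    refine ⟨hσti.intervalIntegrable, fun x hx => ?_⟩
    have hle : max a x₁ ≤ max x x₁ := max_le_max_right _ hx.1
    have e := (hac (max a x₁) (max x x₁) (le_max_right _ _) hle).eq _ ⟨hle, le_rfl⟩
    simp only [hs]
    refine e.trans ?_
    rw [intervalIntegral.integral_of_le hle, intervalIntegral.integral_of_le hx.1, hσt,
      setIntegral_indicator measurableSet_Ioi]
    congr 2
    ext y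
    simp only [mem_Ioc, mem_inter_iff, mem_Ioi, max_lt_iff, le_max_iff]
    constructor
    · rintro ⟨⟨h1, h2⟩, h3 | h3⟩
      · exact ⟨⟨h1, h3⟩, h2⟩
      · exact absurd h3 (not_le.2 h2)
    · rintro ⟨⟨h1, h3⟩, h2⟩
      exact ⟨⟨h1, h2⟩, Or.inl h3⟩
  have hsc : Continuous s := ACI.continuous_of hsac
  set w : ℝ → ℂ := fun x => s x / pt x with hw
  set P : ℝ → ℂ := fun x => (pt x)⁻¹ with hP
  have hwc : Continuous w := hsc.div hptc hpt0
  have hPc : Continuous P := hptc.inv₀ hpt0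
  have hweq : ∀ x, x₁ ≤ x → w x = omg p q z x := fun x hx => by
    have h0 := hpt0 x
    simp only [hw]
    rw [hpteq x (hx₁0.trans hx)] at h0 ⊢
    rw [hseq x hx]
    field_simp
  set c' : ℝ := m * c / Mp with hc'def
  have hc' : 0 < c' := by positivity
  have hwre : ∀ x, c' ≤ (w x).re := by
    intro x
    have e : (w x).re = (p (max x x₁) * (omg p q z (max x x₁)).re) / p (max x 0) := by
      simp only [hw, hpt, hs]
      rw [Complex.div_ofReal_re, Complex.re_ofReal_mul]
    rw [e, hc'def]
    have h1 := hmp (max x x₁) (hx₁0.trans (le_max_right _ _))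
    have h2 := hcω (max x x₁) (le_max_right _ _)
    have h3 := hpM (max x 0) (le_max_right _ _)
    have h4 := hppos x
    have h5 : 0 ≤ p (max x x₁) := hm.le.trans h1
    exact div_le_div₀ (mul_nonneg h5 (hc.le.trans h2)) (mul_le_mul h1 h2 hc.le h5) h4 h3
  have hPb : ∀ x, ‖P x‖ ≤ m⁻¹ := fun x => by
    simp only [hP, hpt]
    rw [norm_inv, Complex.norm_real, Real.norm_of_nonneg (hppos x).le]
    exact inv_anti₀ hm (hmp _ (le_max_right _ _))
  set R₀ : ℝ → ℂ := (Ioc 0 x₁).indicator (fun x => (q x : ℂ) - z - s x * w x) with hR₀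
  have hR₀i : Integrable R₀ := by
    refine (integrable_indicator_iff measurableSet_Ioc).2 ?_
    refine Integrable.sub (Integrable.sub (hPQ.q_intOn hx₁).ofReal ?_) ?_
    · exact integrableOn_const (by simp)
    · exact ((hsc.mul hwc).continuousOn.integrableOn_Icc).mono_set Ioc_subset_Icc_self
  set R : ℝ → ℂ := fun x => R₀ x + σt x with hR
  have hRi : Integrable R := hR₀i.add hσti
  have hRbig : ∀ x, x₁ < x → R x = σ x := fun x hx => by
    have h1 : x ∉ Ioc 0 x₁ := fun h => absurd h.2 (not_le.2 hx)
    simp only [hR, hR₀, hσt]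
    rw [indicator_of_notMem h1, indicator_of_mem (show x ∈ Ioi x₁ from hx), zero_add]
  have hRq : ∀ x, 0 < x → s x * w x + R x - σt x = (q x : ℂ) - z := by
    intro x hx
    rcases le_or_gt x x₁ with h | h
    · have h1 : x ∈ Ioc 0 x₁ := ⟨hx, h⟩
      simp only [hR, hR₀]
      rw [indicator_of_mem h1]; ring
    · have h1 : x ∉ Ioc 0 x₁ := fun h' => absurd h'.2 (not_le.2 h)
      simp only [hR, hR₀]
      rw [indicator_of_notMem h1, hweq x h.le, hseq x h.le]
      have h2 := hsq x h.le
      have h3 := hpt0 x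
      rw [hpteq x hx.le] at h3
      have : (p x : ℂ) * omg p q z x ^ 2 = (q x : ℂ) - z := by rw [h2]; field_simp
      linear_combination this
  obtain ⟨f, h, D, hfc, hfD, hfd, hhc, hhac, hf1, hh1⟩ :=
    volterra_sol hwc hPc hRi hc' hwre hPb
  have hD0 : 0 ≤ D := (norm_nonneg _).trans (hfD 0)
  set W : ℝ → ℂ := fun x => ∫ t in (0:ℝ)..x, w t with hW
  have hWd : ∀ x, HasDerivAt W (w x) x := fun x => (hwc.integral_hasStrictDerivAt 0 x).hasDerivAt
  have hWc : Continuous W := continuous_iff_continuousAt.2 fun x => (hWd x).continuousAt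
  set k : ℂ := cexp (W x₁ - Omg p q z x₁) with hk
  set at' : ℝ → ℂ := fun x => k * cexp (-W x) with hat
  have hatd : ∀ x, HasDerivAt at' (-(w x * at' x)) x := fun x => by
    refine (((hWd x).neg.cexp).const_mul k).congr_deriv ?_
    simp only [hat, Pi.neg_apply]; ring
  have hatc : Continuous at' := by simp only [hat]; fun_prop
  have hateq : ∀ x, x₁ ≤ x → at' x = aa p q z x := by
    intro x hx
    have e1 : Omg p q z x₁ + ∫ t in x₁..x, omg p q z t = Omg p q z x := by
      apply intervalIntegral.integral_add_adjacent_intervals (hPQ.omg_int z hx₁)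
      apply ContinuousOn.intervalIntegrable
      rw [uIcc_of_le hx]
      exact hoc.mono Icc_subset_Ici_self
    have e2 : W x₁ + ∫ t in x₁..x, w t = W x :=
      intervalIntegral.integral_add_adjacent_intervals (hwc.intervalIntegrable _ _)
        (hwc.intervalIntegrable _ _)
    have e3 : ∫ t in x₁..x, w t = ∫ t in x₁..x, omg p q z t := by
      apply intervalIntegral.integral_congr
      intro t ht
      rw [uIcc_of_le hx] at ht
      exact hweq t ht.1
    simp only [hat, hk, aa]
    rw [← Complex.exp_add]
    congr 1
    rw [← e1, ← e2, e3]; ring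
  set θ : ℝ → ℂ := fun x => at' x * f x with hθ
  set θ' : ℝ → ℂ := fun x => at' x * (P x * h x - w x * f x) with hθ'
  have hθd : ∀ x, HasDerivAt θ (θ' x) x := fun x => by
    refine ((hatd x).mul (hfd x)).congr_deriv ?_
    simp only [hθ']; ring
  have hθ'c : Continuous θ' := by simp only [hθ']; fun_prop
  have hθc : Continuous θ := by simp only [hθ]; fun_prop
  -- the tail of R
  have hRtail : ∀ x, x₁ ≤ x → ∫ y in Ioi x, ‖R y‖ ≤ C₁ * eps p' q' x := by
    intro x hx
    have hp'x : IntegrableOn p' (Ioi x) := hPQ.p'_int.mono_set (Ioi_subset_Ioi (hx₁0.trans hx))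
    have hq'x : IntegrableOn q' (Ioi x) := hPQ.q'_int.mono_set (Ioi_subset_Ioi (hx₁.trans hx))
    rw [eps, ← integral_const_mul]
    refine setIntegral_mono_on hRi.norm.integrableOn ((hp'x.abs.add hq'x.abs).const_mul _)
      measurableSet_Ioi fun y hy => ?_
    have hy' : x₁ < y := lt_of_le_of_lt hx hy
    rw [hRbig y hy']
    exact hσb y hy'.le
  have heps0 : ∀ x, 0 ≤ eps p' q' x := fun x => integral_nonneg fun _ => by positivity
  -- bound for ω
  set Cω : ℝ := ‖(-z / (p₀ : ℂ)) ^ (1 / 2 : ℂ)‖ + C₂ * eps p' q' x₁ with hCω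
  have hCω0 : 0 ≤ Cω := by have := heps0 x₁; positivity
  have hepsmono : ∀ x, x₁ ≤ x → eps p' q' x ≤ eps p' q' x₁ := by
    intro x hx
    have hp'x : IntegrableOn p' (Ioi x₁) := hPQ.p'_int.mono_set (Ioi_subset_Ioi hx₁0)
    have hq'x : IntegrableOn q' (Ioi x₁) := hPQ.q'_int.mono_set (Ioi_subset_Ioi hx₁)
    refine setIntegral_mono_set (hp'x.abs.add hq'x.abs) ?_ (Ioi_subset_Ioi hx).eventuallyLE
    exact Eventually.of_forall fun y => by simp only [Pi.zero_apply]; positivity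
  have hωb : ∀ x, x₁ ≤ x → ‖omg p q z x‖ ≤ Cω := by
    intro x hx
    have h1 := hω₀ x hx
    have h2 := norm_sub_norm_le (omg p q z x) ((-z / (p₀ : ℂ)) ^ (1 / 2 : ℂ))
    have h3 := mul_le_mul_of_nonneg_left (hepsmono x hx) hC₂
    rw [hCω]; linarith
  refine ⟨θ, θ', D * C₁ + (C₂ + Cω * (D * C₁) + m⁻¹ * (D * C₁)), ⟨?_, ?_⟩, ?_, ?_, ?_⟩
  · exact fun x _ => (hθd x).hasDerivWithinAt
  · have main : ∀ x y, 0 ≤ x → x ≤ y → (p y : ℂ) * θ' y - (p x : ℂ) * θ' x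
        = ∫ t in x..y, ((q t : ℂ) - z) * θ t := by
      intro x y hx hxy
      have hform : ∀ t, 0 ≤ t → (p t : ℂ) * θ' t = at' t * h t - s t * θ t := by
        intro t ht
        have h0 := hpt0 t
        simp only [hθ', hθ, hP, hw]
        rw [hpteq t ht] at h0 ⊢
        field_simp
      have a1 := (ACI.of_deriv hatd (by fun_prop) x y).mul (hhac x y hxy) hxy
      have a2 := (hsac x y hxy).mul (ACI.of_deriv hθd hθ'c x y) hxy
      rw [hform y (hx.trans hxy), hform x hx]
      have e1 := a1.eq y ⟨hxy, le_rfl⟩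
      have e2 := a2.eq y ⟨hxy, le_rfl⟩
      have e3 : at' y * h y - s y * θ y - (at' x * h x - s x * θ x)
        = (at' y * h y - at' x * h x) - (s y * θ y - s x * θ x) := by ring
      rw [e3, e1, e2, ← intervalIntegral.integral_sub a1.int a2.int]
      rw [intervalIntegral.integral_of_le hxy, intervalIntegral.integral_of_le hxy]
      refine setIntegral_congr_fun measurableSet_Ioc fun t ht => ?_
      have ht0 : 0 < t := lt_of_le_of_lt hx ht.1
      have hsP : s t * P t = w t := by simp only [hw, hP, div_eq_mul_inv]
      rw [← hRq t ht0]
      simp only [hθ, hθ']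
      linear_combination (-(at' t * h t)) * hsP
    intro x hx y hy
    rcases le_total x y with hxy | hxy
    · exact main x y hx hxy
    · rw [intervalIntegral.integral_symm, ← main y x hy hxy]; ring
  · intro x hx
    have e : θ x - aa p q z x = (f x - 1) * aa p q z x := by
      simp only [hθ]; rw [hateq x hx]; ring
    rw [e, norm_mul]
    refine mul_le_mul_of_nonneg_right ?_ (norm_nonneg _)
    have h1 := (hf1 x).trans (mul_le_mul_of_nonneg_left (hRtail x hx) hD0)
    have h2 : 0 ≤ (C₂ + Cω * (D * C₁) + m⁻¹ * (D * C₁)) * eps p' q' x :=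
      mul_nonneg (by positivity) (heps0 x)
    linarith
  · intro x hx
    set ω₀ := (-z / (p₀ : ℂ)) ^ (1 / 2 : ℂ) with hω₀def
    have e : θ' x + ω₀ * aa p q z x =
        (-(omg p q z x - ω₀) - omg p q z x * (f x - 1) + P x * h x) * aa p q z x := by
      simp only [hθ']; rw [hateq x hx, hweq x hx]; ring
    rw [e, norm_mul]
    refine mul_le_mul_of_nonneg_right ?_ (norm_nonneg _)
    have h1 := (hf1 x).trans (mul_le_mul_of_nonneg_left (hRtail x hx) hD0)
    have h2 := (hh1 x).trans (mul_le_mul_of_nonneg_left (hRtail x hx) hD0)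
    have h3 := hω₀ x hx
    have h4 : ‖omg p q z x * (f x - 1)‖ ≤ Cω * (D * (C₁ * eps p' q' x)) := by
      rw [norm_mul]; exact mul_le_mul (hωb x hx) h1 (norm_nonneg _) hCω0
    have h5 : ‖P x * h x‖ ≤ m⁻¹ * (D * (C₁ * eps p' q' x)) := by
      rw [norm_mul]; exact mul_le_mul (hPb x) h2 (norm_nonneg _) (by positivity)
    have h6 : ‖-(omg p q z x - ω₀) - omg p q z x * (f x - 1) + P x * h x‖
        ≤ ‖omg p q z x - ω₀‖ + ‖omg p q z x * (f x - 1)‖ + ‖P x * h x‖ := by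
      refine (norm_add_le _ _).trans (add_le_add_left ?_ _)
      refine (norm_sub_le _ _).trans ?_
      rw [norm_neg]
    have h7 : 0 ≤ D * C₁ * eps p' q' x := mul_nonneg (by positivity) (heps0 x)
    linarith
  · intro _
    have hbd : ∀ x, 0 ≤ x → ‖θ x‖ ^ 2 ≤ (‖k‖ * D) ^ 2 * Real.exp (-(2 * c') * x) := by
      intro x hx
      have h1 := re_primitive hwc hwre hx
      have h2 : ‖θ x‖ ≤ ‖k‖ * D * Real.exp (-(c' * x)) := by
        simp only [hθ, hat]
        rw [norm_mul, norm_mul, Complex.norm_exp (-W x), Complex.neg_re]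
        have h3 : Real.exp (-(W x).re) ≤ Real.exp (-(c' * x)) :=
          Real.exp_le_exp.2 (neg_le_neg h1)
        calc ‖k‖ * Real.exp (-(W x).re) * ‖f x‖ ≤ ‖k‖ * Real.exp (-(c' * x)) * D := by
              gcongr; exact hfD x
          _ = _ := by ring
      calc ‖θ x‖ ^ 2 ≤ (‖k‖ * D * Real.exp (-(c' * x))) ^ 2 := by gcongr
        _ = _ := by
          rw [mul_pow, ← Real.exp_nat_mul]
          congr 2; push_cast; ring
    have hexp : IntegrableOn (fun x => (‖k‖ * D) ^ 2 * Real.exp (-(2 * c') * x)) (Ioi (0:ℝ)) :=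
      (exp_neg_integrableOn_Ioi 0 (by positivity)).const_mul _
    refine Integrable.mono' hexp (hθc.norm.pow 2).aestronglyMeasurable ?_
    refine (ae_restrict_iff' measurableSet_Ioi).2 (Eventually.of_forall fun y hy => ?_)
    rw [Real.norm_of_nonneg (by positivity)]
    exact hbd y (le_of_lt hy)

end
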